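/- In the setting of part (1) of Yang–Stufken's complete class theorem, suppose additionally that k is even and that the index of ξ satisfies I(ξ) ≥ k/2. Then the improving design ξ⁺ can be chosen to have at most (k+2)/2 support points, with both A and B support points of ξ⁺; that is, there exists a finitely supported probability measure ξ⁺ on [A,B] with at most (k+2)/2 support points, {A,B} ⊆ supp(ξ⁺), ∫_A^B Ψ_i dξ⁺ = ∫_A^B Ψ_i dξ for all i = 0,…,k−1, and ∫_A^B C₂₂ dξ⁺ − ∫_A^B C₂₂ dξ positive semidefinite. -/

import Mathlib

open MeasureTheory Set Matrix

/-- A family of functions `Ψ₀, …, Ψ_{k-1}` is a Chebyshev system on `[A,B]` if for all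
points `A ≤ x₀ < x₁ < ⋯ < x_{k-1} ≤ B` the matrix `(Ψ i (x j))` has positive determinant. -/
def IsChebyshevSystem (A B : ℝ) {k : ℕ} (Ψ : Fin k → ℝ → ℝ) : Prop :=
  ∀ x : Fin k → ℝ, StrictMono x → (∀ j, x j ∈ Set.Icc A B) →
    0 < (Matrix.of fun i j : Fin k => Ψ i (x j)).det

/-- `ξ` is a design on `[A,B]`: a finitely supported probability measure
`ξ = ∑_{x ∈ s} w_x δ_x` with support points `s ⊆ [A,B]` and positive weights. -/
def IsDesignOn (A B : ℝ) (ξ : Measure ℝ) (s : Finset ℝ) : Prop :=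
  IsProbabilityMeasure ξ ∧ ↑s ⊆ Set.Icc A B ∧ (∀ x ∈ s, 0 < ξ {x}) ∧
    ξ = ∑ x ∈ s, ξ {x} • Measure.dirac x

/-- The entrywise integral `∫ C₂₂(x) dξ(x)` of a matrix-valued function. -/
noncomputable def matrixIntegral {p₁ : ℕ} (C : ℝ → Matrix (Fin p₁) (Fin p₁) ℝ)
    (ξ : Measure ℝ) : Matrix (Fin p₁) (Fin p₁) ℝ :=
  Matrix.of fun a b => ∫ x, C x a b ∂ξ

open Classical in
/-- The index of a design with support `s` on `[A,B]`: the number of support points in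
the open interval `(A,B)` plus one half times the number of support points among the
endpoints `{A, B}`. -/
noncomputable def designIndex (A B : ℝ) (s : Finset ℝ) : ℝ :=
  ((s.filter fun x => x ∈ Set.Ioo A B).card : ℝ) +
    ((s.filter fun x => x = A ∨ x = B).card : ℝ) / 2

/-- In a finite-dimensional space the convex hull of a compact set is compact. -/
theorem isCompact_convexHull_of_finiteDimensional {E : Type*} [NormedAddCommGroup E]
    [NormedSpace ℝ E] [FiniteDimensional ℝ E] {K : Set E} (hK : IsCompact K) :
    IsCompact (convexHull ℝ K) := by
  have key : convexHull ℝ K = ⋃ n ∈ Finset.range (Module.finrank ℝ E + 2),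
      (fun p : (Fin n → ℝ) × (Fin n → E) => ∑ i, p.1 i • p.2 i) ''
        (stdSimplex ℝ (Fin n) ×ˢ Set.univ.pi fun _ => K) := by
    ext x
    simp only [Set.mem_iUnion, Set.mem_image, Set.mem_prod, Prod.exists]
    constructor
    · intro hx
      obtain ⟨ι, _, z, w, hz, hind, hw, hw1, rfl⟩ := eq_pos_convex_span_of_mem_convexHull hx
      have hcard : Fintype.card ι ≤ Module.finrank ℝ E + 1 :=
        hind.card_le_finrank_succ.trans (Nat.succ_le_succ (Submodule.finrank_le _))
      let e := (Fintype.equivFin ι).symm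
      refine ⟨Fintype.card ι, Finset.mem_range.2 (by omega), w ∘ e, z ∘ e,
        ⟨⟨fun i => (hw _).le, ?_⟩, fun i _ => hz ⟨_, rfl⟩⟩, ?_⟩
      · rw [← hw1]; exact e.sum_comp w
      · exact e.sum_comp fun i => w i • z i
    · rintro ⟨n, -, w, z, ⟨⟨hw, hw1⟩, hz⟩, rfl⟩
      exact mem_convexHull_of_exists_fintype w z hw hw1 (fun i => hz i trivial) rfl
  rw [key]
  refine (Finset.finite_toSet _).isCompact_biUnion fun n _ => ?_
  refine ((isCompact_stdSimplex ℝ (Fin n)).prod (isCompact_univ_pi fun _ => hK)).image ?_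
  fun_prop

/-- `w` is a finitely supported nonnegative weight function on `[A,B]`. -/
def IsWeightOn (A B : ℝ) (w : ℝ →₀ ℝ) : Prop :=
  (∀ x, 0 ≤ w x) ∧ ↑w.support ⊆ Set.Icc A B

/-- The integral of `f` against the discrete signed measure with weights `w`. -/
noncomputable abbrev weightIntegral (f : ℝ → ℝ) : (ℝ →₀ ℝ) →ₗ[ℝ] ℝ :=
  Finsupp.linearCombination ℝ f

theorem weightIntegral_eq_sum_of_subset (f : ℝ → ℝ) {w : ℝ →₀ ℝ} {T : Finset ℝ}
    (h : w.support ⊆ T) : weightIntegral f w = ∑ x ∈ T, w x * f x := by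
  rw [Finsupp.linearCombination_apply, Finsupp.sum_of_support_subset w h _ (by simp)]
  rfl

theorem IsWeightOn.add {A B : ℝ} {v w : ℝ →₀ ℝ} (hv : IsWeightOn A B v) (hw : IsWeightOn A B w) :
    IsWeightOn A B (v + w) := by
  refine ⟨fun x => add_nonneg (hv.1 x) (hw.1 x), fun x hx => ?_⟩
  rcases Finset.mem_union.1 (Finsupp.support_add hx) with h | h
  exacts [hv.2 h, hw.2 h]

theorem isWeightOn_single {A B x r : ℝ} (hx : x ∈ Set.Icc A B) (hr : 0 ≤ r) :
    IsWeightOn A B (Finsupp.single x r) := by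
  refine ⟨fun y => ?_, fun y hy => ?_⟩
  · rw [Finsupp.single_apply]; split_ifs <;> simp [hr]
  · have := Finsupp.support_single_subset hy
    simp only [Finset.mem_singleton] at this
    exact this ▸ hx

theorem IsWeightOn.smul {A B r : ℝ} {w : ℝ →₀ ℝ} (hw : IsWeightOn A B w) (hr : 0 ≤ r) :
    IsWeightOn A B (r • w) :=
  ⟨fun x => mul_nonneg hr (hw.1 x), fun _ hx => hw.2 (Finsupp.support_smul hx)⟩

theorem isWeightOn_sum {ι : Type*} {A B : ℝ} {t : Finset ι} {w : ι → ℝ →₀ ℝ}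
    (h : ∀ i ∈ t, IsWeightOn A B (w i)) : IsWeightOn A B (∑ i ∈ t, w i) :=
  Finset.sum_induction _ (IsWeightOn A B) (fun _ _ => IsWeightOn.add) ⟨by simp, by simp⟩ h

/-- Among the weights with prescribed positive mass and prescribed moments, some weight maximizes
the integral of a continuous function. -/
theorem exists_weightIntegral_maximizer {ι : Type*} [Fintype ι] {A B : ℝ} {u : ι → ℝ → ℝ}
    {g : ℝ → ℝ} (hu : ∀ i, ContinuousOn (u i) (Set.Icc A B)) (hg : ContinuousOn g (Set.Icc A B))
    {i₀ : ι} (hi₀ : ∀ x, u i₀ x = 1) {w : ℝ →₀ ℝ} (hw : IsWeightOn A B w)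
    (hpos : 0 < weightIntegral (u i₀) w) :
    ∃ v, IsWeightOn A B v ∧ (∀ i, weightIntegral (u i) v = weightIntegral (u i) w) ∧
      ∀ v', IsWeightOn A B v' → (∀ i, weightIntegral (u i) v' = weightIntegral (u i) w) →
        weightIntegral g v' ≤ weightIntegral g v := by
  set M := weightIntegral (u i₀) w with hM
  let F : ℝ → (ι → ℝ) × ℝ := fun x => (fun i => u i x, g x)
  let K : Set ((ι → ℝ) × ℝ) := convexHull ℝ (F '' Set.Icc A B)
  have hK : IsCompact K := isCompact_convexHull_of_finiteDimensional
    (isCompact_Icc.image_of_continuousOn ((continuousOn_pi.2 hu).prodMk hg))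
  have memK : ∀ v, IsWeightOn A B v → (∀ i, weightIntegral (u i) v = weightIntegral (u i) w) →
      ((fun i => M⁻¹ * weightIntegral (u i) w, M⁻¹ * weightIntegral g v) : (ι → ℝ) × ℝ) ∈ K := by
    intro v hv hvm
    have h1 := hvm i₀
    rw [← hM, weightIntegral_eq_sum_of_subset _ subset_rfl] at h1
    simp only [hi₀, mul_one] at h1
    have := (convex_convexHull ℝ (F '' Set.Icc A B)).sum_mem (t := v.support)
      (w := fun x => M⁻¹ * v x) (z := F)
      (fun x _ => mul_nonneg (inv_nonneg.2 hpos.le) (hv.1 x))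
      (by rw [← Finset.mul_sum, h1, inv_mul_cancel₀ hpos.ne'])
      (fun x hx => subset_convexHull ℝ _ ⟨x, hv.2 hx, rfl⟩)
    convert this using 1
    ext i
    · change M⁻¹ * weightIntegral (u i) w = _
      rw [← hvm i, weightIntegral_eq_sum_of_subset _ subset_rfl]
      simp [F, Prod.fst_sum, Finset.sum_apply, Finset.mul_sum, mul_assoc]
    · change M⁻¹ * weightIntegral g v = _
      rw [weightIntegral_eq_sum_of_subset _ subset_rfl]
      simp [F, Prod.snd_sum, Finset.mul_sum, mul_assoc]
  have hS : IsCompact (K ∩ Prod.fst ⁻¹' {fun i => M⁻¹ * weightIntegral (u i) w}) :=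
    hK.inter_right (isClosed_singleton.preimage continuous_fst)
  obtain ⟨p, ⟨hpK, hp1⟩, hpmax⟩ := hS.exists_isMaxOn ⟨_, memK w hw fun _ => rfl, rfl⟩
    continuous_snd.continuousOn
  obtain ⟨κ, _, c, z, hc, hc1, hz, hcz⟩ := mem_convexHull_iff_exists_fintype.1 hpK
  choose y hy hyz using hz
  have hval : ∀ f : ℝ → ℝ, weightIntegral f (∑ i, Finsupp.single (y i) (M * c i)) =
      M * ∑ i, c i * f (y i) := fun f => by
    simp only [map_sum, Finsupp.linearCombination_single, smul_eq_mul, Finset.mul_sum, mul_assoc]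
  refine ⟨∑ i, Finsupp.single (y i) (M * c i),
    isWeightOn_sum fun i _ => isWeightOn_single (hy i) (mul_nonneg hpos.le (hc i)),
    fun i => ?_, fun v' hv' hvm' => ?_⟩
  · have h2 := congrFun hp1 i
    rw [hval, ← mul_inv_cancel_left₀ hpos.ne' (weightIntegral (u i) w), ← h2, ← hcz]
    simp [← hyz, F, Prod.fst_sum, Finset.sum_apply]
  · have h2 : M⁻¹ * weightIntegral g v' ≤ p.2 := hpmax ⟨memK v' hv' hvm', rfl⟩
    rw [hval, ← mul_inv_cancel_left₀ hpos.ne' (weightIntegral g v')]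
    refine mul_le_mul_of_nonneg_left (h2.trans_eq ?_) hpos.le
    rw [← hcz]
    simp [← hyz, F, Prod.snd_sum]

/-- Weights on at most `k` points with vanishing moments against a Chebyshev system of `k`
functions vanish. -/
theorem IsChebyshevSystem.eq_zero_of_weightIntegral_eq_zero {A B : ℝ} (hAB : A < B) {k : ℕ}
    {u : Fin k → ℝ → ℝ} (hu : IsChebyshevSystem A B u) {w : ℝ →₀ ℝ}
    (hw : ↑w.support ⊆ Set.Icc A B) (hcard : w.support.card ≤ k)
    (h : ∀ i, weightIntegral (u i) w = 0) : w = 0 := by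
  obtain ⟨t, ht, htc⟩ := ((Set.Icc_infinite hAB).sdiff
    w.support.finite_toSet).exists_subset_card_eq (k - w.support.card)
  have hdisj : Disjoint w.support t :=
    Finset.disjoint_left.2 fun x hx hxt => (ht hxt).2 hx
  have hT : (w.support ∪ t).card = k := by
    rw [Finset.card_union_of_disjoint hdisj, htc]; omega
  set x := (w.support ∪ t).orderEmbOfFin hT with hxdef
  have hmem : ∀ j, x j ∈ w.support ∪ t := Finset.orderEmbOfFin_mem _ hT
  have hdet := hu x x.strictMono fun j => by
    rcases Finset.mem_union.1 (hmem j) with hj | hj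
    exacts [hw hj, (ht hj).1]
  have hv := Matrix.eq_zero_of_mulVec_eq_zero hdet.ne' (v := fun j => w (x j)) <| by
    ext i
    have := h i
    rw [weightIntegral_eq_sum_of_subset _ Finset.subset_union_left (T := w.support ∪ t),
      ← Finset.image_orderEmbOfFin_univ _ hT, Finset.sum_image x.injective.injOn] at this
    simpa [Matrix.mulVec, dotProduct, mul_comm] using this
  ext y
  by_contra hy
  have : y ∈ Set.range x := by
    rw [hxdef, Finset.range_orderEmbOfFin]
    exact Finset.mem_coe.2 (Finset.mem_union_left _ (Finsupp.mem_support_iff.2 hy))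
  obtain ⟨j, rfl⟩ := this
  exact hy (congrFun hv j)

/-- The cofactors along an extra last row of a Chebyshev system alternate in sign. -/
theorem IsChebyshevSystem.exists_alternating_cofactors {A B : ℝ} {k : ℕ} {u : Fin k → ℝ → ℝ}
    (hu : IsChebyshevSystem A B u) {x : Fin (k + 1) → ℝ} (hx : StrictMono x)
    (hxI : ∀ j, x j ∈ Set.Icc A B) :
    ∃ c : Fin (k + 1) → ℝ, (∀ j, 0 < c j) ∧ ∀ f : ℝ → ℝ,
      ∑ j : Fin (k + 1), (-1) ^ (k + (j : ℕ)) * c j * f (x j) =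
        (Matrix.of fun i j => (Fin.snoc u f : Fin (k + 1) → ℝ → ℝ) i (x j)).det := by
  refine ⟨fun j => (Matrix.of fun i l => u i (x (j.succAbove l))).det, fun j =>
    hu _ (hx.comp (Fin.strictMono_succAbove j)) fun l => hxI _, fun f => ?_⟩
  rw [Matrix.det_succ_row _ (Fin.last k)]
  refine Finset.sum_congr rfl fun j _ => ?_
  have : (Matrix.of fun i j => (Fin.snoc u f : Fin (k + 1) → ℝ → ℝ) i (x j)).submatrix
      (Fin.last k).succAbove j.succAbove = Matrix.of fun i l => u i (x (j.succAbove l)) := by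
    ext i l; simp
  rw [this]
  simp
  ring

/-- There are signed weights at the given points, alternating in sign, with vanishing moments
against the Chebyshev system, and with positive integral against every function extending it. -/
theorem IsChebyshevSystem.exists_alternating_weights {A B : ℝ} {k : ℕ} {u : Fin k → ℝ → ℝ}
    (hu : IsChebyshevSystem A B u) (hk : Even k) {x : Fin (k + 1) → ℝ} (hx : StrictMono x)
    (hxI : ∀ j, x j ∈ Set.Icc A B) :
    ∃ σ : ℝ →₀ ℝ, ↑σ.support ⊆ Set.Icc A B ∧ (∀ j : Fin (k + 1), Even (j : ℕ) → 0 < σ (x j)) ∧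
      (∀ y, σ y < 0 → ∃ j : Fin (k + 1), Odd (j : ℕ) ∧ x j = y) ∧ (∀ i, weightIntegral (u i) σ = 0) ∧
      ∀ g, IsChebyshevSystem A B (Fin.snoc u g : Fin (k + 1) → ℝ → ℝ) →
        0 < weightIntegral g σ := by
  obtain ⟨c, hc, hdet⟩ := hu.exists_alternating_cofactors hx hxI
  set σ : ℝ →₀ ℝ := ∑ j, Finsupp.single (x j) ((-1) ^ (k + (j : ℕ)) * c j) with hσ
  have hval : ∀ j, σ (x j) = (-1) ^ (k + (j : ℕ)) * c j := fun j => by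
    rw [hσ, Finsupp.finsetSum_apply, Finset.sum_eq_single j]
    · simp
    · intro i _ hij
      exact Finsupp.single_eq_of_ne (hx.injective.ne hij.symm)
    · simp
  have hsupp : ∀ y ∈ σ.support, ∃ j, x j = y := fun y hy => by
    obtain ⟨j, -, hj⟩ := Finset.mem_biUnion.1 (Finsupp.support_finsetSum hy)
    have := Finsupp.support_single_subset hj
    simp only [Finset.mem_singleton] at this
    exact ⟨j, this.symm⟩
  have hint : ∀ f : ℝ → ℝ, weightIntegral f σ =
      (Matrix.of fun i j => (Fin.snoc u f : Fin (k + 1) → ℝ → ℝ) i (x j)).det := fun f => by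
    rw [← hdet, hσ]
    simp only [map_sum, Finsupp.linearCombination_single, smul_eq_mul]
  refine ⟨σ, fun y hy => ?_, fun j hj => ?_, fun y hy => ?_, fun i => ?_, fun g hg => ?_⟩
  · obtain ⟨j, rfl⟩ := hsupp y hy
    exact hxI j
  · rw [hval, (hk.add hj).neg_one_pow, one_mul]
    exact hc j
  · obtain ⟨j, rfl⟩ := hsupp y (Finsupp.mem_support_iff.2 hy.ne)
    refine ⟨j, Nat.not_even_iff_odd.1 fun hj => ?_, rfl⟩
    rw [hval, (hk.add hj).neg_one_pow, one_mul] at hy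
    exact hy.not_gt (hc j)
  · rw [hint]
    refine Matrix.det_zero_of_row_eq (i := i.castSucc) (j := Fin.last k)
      (Fin.castSucc_lt_last i).ne ?_
    ext j
    simp
  · rw [hint]
    exact hg x hx hxI

/-- Finitely many points of `(A,B)` can be interlaced with points of `[A,B]`, starting at `A` and
ending at `B`. -/
theorem exists_strictMono_interlacing {A B : ℝ} {m : ℕ} (hm : 0 < m) {T : Finset ℝ}
    (hT : T.card = m) (hTI : ↑T ⊆ Set.Ioo A B) :
    ∃ x : Fin (2 * m + 1) → ℝ, StrictMono x ∧ (∀ j, x j ∈ Set.Icc A B) ∧ x 0 = A ∧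
      x (Fin.last _) = B ∧ ∀ j : Fin (2 * m + 1), Odd (j : ℕ) → x j ∈ T := by
  set e := T.orderEmbOfFin hT
  have heT : ∀ i, e i ∈ T := Finset.orderEmbOfFin_mem _ hT
  let y : ℕ → ℝ := fun l => if l = 0 then A else if h : l - 1 < m then e ⟨l - 1, h⟩ else B
  have hy0 : y 0 = A := rfl
  have hyB : y (m + 1) = B := by simp [y]
  have hyT : ∀ l, l < m → y (l + 1) ∈ T := fun l hl => by simp [y, hl, heT]
  have hymono : ∀ l, l ≤ m → y l < y (l + 1) := by
    intro l hl
    rcases Nat.eq_zero_or_pos l with rfl | hl0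
    · exact (hTI (hyT 0 hm)).1
    · obtain ⟨n, rfl⟩ : ∃ n, l = n + 1 := ⟨l - 1, by omega⟩
      rcases hl.eq_or_lt with h | h
      · rw [h, hyB, ← h]
        exact (hTI (hyT n (by omega))).2
      · have h1 : n < m := by omega
        simp only [y, Nat.add_sub_cancel, Nat.succ_ne_zero, if_false, h1, h, dif_pos]
        exact e.strictMono (by simp [Fin.lt_def])
  let z : ℕ → ℝ := fun j =>
    if j = 0 then A else if j = 2 * m then B else (y ((j + 1) / 2) + y (j / 2 + 1)) / 2
  have hz0 : z 0 = A := rfl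
  have hzB : z (2 * m) = B := by simp [z, hm.ne']
  have hzodd : ∀ l, z (2 * l + 1) = y (l + 1) := fun l => by
    have h1 : 2 * l + 1 ≠ 2 * m := by omega
    have h2 : (2 * l + 1 + 1) / 2 = l + 1 := by omega
    have h3 : (2 * l + 1) / 2 = l := by omega
    simp only [z, h1, h2, h3, if_false, Nat.succ_ne_zero]
    ring
  have hzeven : ∀ l, 0 < l → l < m → z (2 * l) = (y l + y (l + 1)) / 2 := fun l h0 hl => by
    have h1 : 2 * l ≠ 2 * m := by omega
    have h2 : (2 * l + 1) / 2 = l := by omega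
    have h3 : 2 * l / 2 = l := by omega
    have h4 : 2 * l ≠ 0 := by omega
    simp only [z, h1, h2, h3, h4, if_false]
  have hstep : ∀ j, j < 2 * m → z j < z (j + 1) := by
    intro j hj
    rcases Nat.even_or_odd' j with ⟨l, rfl | rfl⟩
    · rw [hzodd]
      have h1 := hymono l (by omega)
      rcases Nat.eq_zero_or_pos l with rfl | hl0
      · exact h1
      · rw [hzeven l hl0 (by omega)]; linarith
    · rw [hzodd]
      have h1 := hymono (l + 1) (by omega)
      change _ < z (2 * (l + 1))
      rcases (show l + 1 ≤ m by omega).eq_or_lt with h | h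
      · rw [h, hzB, ← h, ← hyB, ← h]; exact h1
      · rw [hzeven (l + 1) (by omega) h]; linarith
  have hmono : StrictMono fun j : Fin (2 * m + 1) => z j :=
    Fin.strictMono_iff_lt_succ.2 fun i => hstep i i.2
  refine ⟨fun j => z j, hmono, fun j => ⟨?_, ?_⟩, hz0, by simpa using hzB, ?_⟩
  · exact hz0.symm.trans_le (hmono.monotone (Fin.zero_le j))
  · exact (hmono.monotone (Fin.le_last j)).trans_eq (by simpa using hzB)
  · rintro ⟨j, hj⟩ ⟨l, hl : j = 2 * l + 1⟩
    change z j ∈ T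
    rw [hl, hzodd]
    exact hyT l (by omega)

theorem IsWeightOn.mem_Ioo_of_mem_support_sdiff {A B : ℝ} {w : ℝ →₀ ℝ} (hw : IsWeightOn A B w)
    {y : ℝ} (hy : y ∈ w.support \ {A, B}) : y ∈ Set.Ioo A B := by
  simp only [Finset.mem_sdiff, Finset.mem_insert, Finset.mem_singleton, not_or] at hy
  have h := hw.2 hy.1
  exact ⟨lt_of_le_of_ne h.1 (Ne.symm hy.2.1), lt_of_le_of_ne h.2 hy.2.2⟩

/-- Weights with at least `m` interior support points can be strictly improved, with unchanged
moments against a Chebyshev system of `2 * m` functions, so as to charge both endpoints. -/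
theorem IsWeightOn.exists_improvement {A B : ℝ} {m : ℕ} (hm : 0 < m)
    {u : Fin (2 * m) → ℝ → ℝ} (hu : IsChebyshevSystem A B u) {w : ℝ →₀ ℝ}
    (hw : IsWeightOn A B w) (hcard : m ≤ (w.support \ {A, B}).card) :
    ∃ v, IsWeightOn A B v ∧ 0 < v A ∧ 0 < v B ∧
      (∀ i, weightIntegral (u i) v = weightIntegral (u i) w) ∧
      ∀ g, IsChebyshevSystem A B (Fin.snoc u g : Fin (2 * m + 1) → ℝ → ℝ) →
        weightIntegral g w < weightIntegral g v := by
  obtain ⟨T, hTsub, hT⟩ := Finset.exists_subset_card_eq hcard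
  obtain ⟨x, hx, hxI, hxA, hxB, hxT⟩ := exists_strictMono_interlacing hm hT
    fun y hy => hw.mem_Ioo_of_mem_support_sdiff (hTsub hy)
  obtain ⟨σ, hσI, hσpos, hσneg, hσ0, hσg⟩ := hu.exists_alternating_weights (even_two_mul m) hx hxI
  have hev : ∀ᶠ ε : ℝ in nhdsWithin 0 (Set.Ioi 0), ∀ y ∈ w.support, 0 < w y + ε * σ y := by
    refine nhdsWithin_le_nhds ((Filter.eventually_all_finset _).2 fun y hy => ?_)
    have hc : Continuous fun ε : ℝ => w y + ε * σ y := by fun_prop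
    refine continuous_const.continuousAt.eventually_lt hc.continuousAt ?_
    simpa using (hw.1 y).lt_of_ne' (Finsupp.mem_support_iff.1 hy)
  obtain ⟨ε, hε, hε0 : 0 < ε⟩ := (hev.and self_mem_nhdsWithin).exists
  have hA : 0 < σ A := hxA ▸ hσpos 0 (by simp)
  have hB : 0 < σ B := hxB ▸ hσpos (Fin.last _) (by simp)
  refine ⟨w + ε • σ, ⟨fun y => ?_, fun y hy => ?_⟩, ?_, ?_, fun i => ?_, fun g hg => ?_⟩
  · change 0 ≤ w y + ε * σ y
    by_cases hy : σ y < 0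
    · obtain ⟨j, hj, rfl⟩ := hσneg y hy
      exact (hε _ (Finset.mem_sdiff.1 (hTsub (hxT j hj))).1).le
    · exact add_nonneg (hw.1 y) (mul_nonneg hε0.le (not_lt.1 hy))
  · rcases Finset.mem_union.1 (Finsupp.support_add hy) with h | h
    exacts [hw.2 h, hσI (Finsupp.support_smul h)]
  · exact add_pos_of_nonneg_of_pos (hw.1 A) (mul_pos hε0 hA)
  · exact add_pos_of_nonneg_of_pos (hw.1 B) (mul_pos hε0 hB)
  · rw [map_add, map_smul, hσ0, smul_zero, add_zero]
  · rw [map_add, map_smul]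
    exact lt_add_of_pos_right _ (mul_pos hε0 (hσg g hg))

/-- Every positive weight is dominated, simultaneously for all functions extending the Chebyshev
system of `2 * m` functions, by one with fewer than `m` interior support points. -/
theorem IsWeightOn.exists_dominating {A B : ℝ} (hAB : A < B) {m : ℕ} (hm : 0 < m)
    {u : Fin (2 * m) → ℝ → ℝ} (hu : IsChebyshevSystem A B u)
    (hcont : ∀ i, ContinuousOn (u i) (Set.Icc A B)) {i₀ : Fin (2 * m)} (hi₀ : ∀ x, u i₀ x = 1)
    {G : Set (ℝ → ℝ)} (hG : G.Nonempty) (hGcont : ∀ g ∈ G, ContinuousOn g (Set.Icc A B))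
    (hGu : ∀ g ∈ G, IsChebyshevSystem A B (Fin.snoc u g : Fin (2 * m + 1) → ℝ → ℝ))
    {w : ℝ →₀ ℝ} (hw : IsWeightOn A B w) (hpos : 0 < weightIntegral (u i₀) w) :
    ∃ v, IsWeightOn A B v ∧ (v.support \ {A, B}).card < m ∧
      (∀ i, weightIntegral (u i) v = weightIntegral (u i) w) ∧
      ∀ g ∈ G, weightIntegral g w ≤ weightIntegral g v := by
  have key : ∀ g ∈ G, ∃ v, IsWeightOn A B v ∧ (v.support \ {A, B}).card < m ∧
      (∀ i, weightIntegral (u i) v = weightIntegral (u i) w) ∧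
      weightIntegral g w ≤ weightIntegral g v := fun g hg => by
    obtain ⟨v, hv, hvm, hmax⟩ :=
      exists_weightIntegral_maximizer hcont (hGcont g hg) hi₀ hw hpos
    refine ⟨v, hv, not_le.1 fun hcard => ?_, hvm, hmax w hw fun _ => rfl⟩
    obtain ⟨v', hv', -, -, hvm', hlt⟩ := hv.exists_improvement hm hu hcard
    exact (hlt g (hGu g hg)).not_ge (hmax v' hv' fun i => (hvm' i).trans (hvm i))
  obtain ⟨g₀, hg₀⟩ := hG
  obtain ⟨v, hv, hvc, hvm, -⟩ := key g₀ hg₀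
  refine ⟨v, hv, hvc, hvm, fun g hg => ?_⟩
  obtain ⟨v', hv', hvc', hvm', hle⟩ := key g hg
  have hsub : (v' - v).support ⊆ (v'.support \ {A, B}) ∪ (v.support \ {A, B}) ∪ {A, B} := by
    intro y hy
    have := Finsupp.support_sub hy
    simp only [Finset.mem_union, Finset.mem_sdiff] at this ⊢
    tauto
  have hzero : v' - v = 0 := by
    refine hu.eq_zero_of_weightIntegral_eq_zero hAB (fun y hy => ?_) ?_ fun i => ?_
    · rcases Finset.mem_union.1 (Finsupp.support_sub hy) with h | h
      exacts [hv'.2 h, hv.2 h]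
    · have h1 := Finset.card_le_card hsub
      have h2 := Finset.card_union_le ((v'.support \ {A, B}) ∪ (v.support \ {A, B})) {A, B}
      have h3 := Finset.card_union_le (v'.support \ {A, B}) (v.support \ {A, B})
      have h4 := Finset.card_le_two (a := A) (b := B)
      omega
    · rw [map_sub, hvm', hvm, sub_self]
  rwa [← sub_eq_zero.1 hzero]

/-- A weight of index at least `m` is dominated, simultaneously for all functions extending the
Chebyshev system of `2 * m` functions, by one on `m + 1` points including both endpoints. -/
theorem IsWeightOn.exists_dominating_endpoints {A B : ℝ} (hAB : A < B) {m : ℕ} (hm : 0 < m)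
    {u : Fin (2 * m) → ℝ → ℝ} (hu : IsChebyshevSystem A B u)
    (hcont : ∀ i, ContinuousOn (u i) (Set.Icc A B)) {i₀ : Fin (2 * m)} (hi₀ : ∀ x, u i₀ x = 1)
    {G : Set (ℝ → ℝ)} (hG : G.Nonempty) (hGcont : ∀ g ∈ G, ContinuousOn g (Set.Icc A B))
    (hGu : ∀ g ∈ G, IsChebyshevSystem A B (Fin.snoc u g : Fin (2 * m + 1) → ℝ → ℝ))
    {w : ℝ →₀ ℝ} (hw : IsWeightOn A B w)
    (hidx : m ≤ (w.support \ {A, B}).card ∨ 0 < w A ∧ 0 < w B) :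
    ∃ v, IsWeightOn A B v ∧ v.support.card ≤ m + 1 ∧ 0 < v A ∧ 0 < v B ∧
      (∀ i, weightIntegral (u i) v = weightIntegral (u i) w) ∧
      ∀ g ∈ G, weightIntegral g w ≤ weightIntegral g v := by
  obtain ⟨v, hv, hvA, hvB, hvm, hvg⟩ : ∃ v, IsWeightOn A B v ∧ 0 < v A ∧ 0 < v B ∧
      (∀ i, weightIntegral (u i) v = weightIntegral (u i) w) ∧
      ∀ g ∈ G, weightIntegral g w ≤ weightIntegral g v := by
    rcases hidx with h | ⟨hA, hB⟩
    · obtain ⟨v, hv, hvA, hvB, hvm, hvg⟩ := hw.exists_improvement hm hu h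
      exact ⟨v, hv, hvA, hvB, hvm, fun g hg => (hvg g (hGu g hg)).le⟩
    · exact ⟨w, hw, hA, hB, fun _ => rfl, fun _ _ => le_rfl⟩
  have hAI : A ∈ Set.Icc A B := Set.left_mem_Icc.2 hAB.le
  have hBI : B ∈ Set.Icc A B := Set.right_mem_Icc.2 hAB.le
  set e : ℝ →₀ ℝ := Finsupp.single A (v A / 2) + Finsupp.single B (v B / 2) with he
  have heW : IsWeightOn A B e :=
    (isWeightOn_single hAI (half_pos hvA).le).add (isWeightOn_single hBI (half_pos hvB).le)
  have heA : e A = v A / 2 := by simp [he, hAB.ne']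
  have heB : e B = v B / 2 := by simp [he, hAB.ne]
  have hey : ∀ y, y ≠ A → y ≠ B → e y = 0 := fun y h1 h2 => by simp [he, h1, h2]
  have hr : IsWeightOn A B (v - e) := by
    refine ⟨fun y => ?_, fun y hy => ?_⟩
    · rw [Finsupp.sub_apply]
      by_cases h1 : y = A
      · rw [h1, heA]; linarith
      by_cases h2 : y = B
      · rw [h2, heB]; linarith
      rw [hey y h1 h2, sub_zero]
      exact hv.1 y
    · rcases Finset.mem_union.1 (Finsupp.support_sub hy) with h | h
      exacts [hv.2 h, heW.2 h]
  have hpos : 0 < weightIntegral (u i₀) (v - e) := by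
    rw [weightIntegral_eq_sum_of_subset _ subset_rfl]
    simp only [hi₀, mul_one]
    refine Finset.sum_pos (fun y hy => (hr.1 y).lt_of_ne' (Finsupp.mem_support_iff.1 hy)) ⟨A, ?_⟩
    rw [Finsupp.mem_support_iff, Finsupp.sub_apply, heA]
    linarith
  obtain ⟨r, hrW, hrc, hrm, hrg⟩ :=
    hr.exists_dominating hAB hm hu hcont hi₀ hG hGcont hGu hpos
  refine ⟨r + e, hrW.add heW, ?_, ?_, ?_, fun i => ?_, fun g hg => ?_⟩
  · have hsub : (r + e).support ⊆ (r.support \ {A, B}) ∪ {A, B} := by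
      intro y hy
      by_cases h1 : y = A
      · simp [h1]
      by_cases h2 : y = B
      · simp [h2]
      rw [Finsupp.mem_support_iff, Finsupp.add_apply, hey y h1 h2, add_zero] at hy
      simp [h1, h2, hy]
    have h1 := Finset.card_le_card hsub
    have h2 := Finset.card_union_le (r.support \ {A, B}) {A, B}
    have h3 := Finset.card_le_two (a := A) (b := B)
    omega
  · rw [Finsupp.add_apply, heA]
    exact add_pos_of_nonneg_of_pos (hrW.1 A) (half_pos hvA)
  · rw [Finsupp.add_apply, heB]
    exact add_pos_of_nonneg_of_pos (hrW.1 B) (half_pos hvB)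
  · rw [map_add, hrm, map_sub, sub_add_cancel, hvm]
  · have := hrg g hg
    rw [map_sub] at this
    rw [map_add]
    linarith [hvg g hg]

theorem IsDesignOn.exists_weight {A B : ℝ} {ξ : Measure ℝ} {s : Finset ℝ}
    (hξ : IsDesignOn A B ξ s) :
    ∃ w, IsWeightOn A B w ∧ w.support = s ∧ ∀ f : ℝ → ℝ, ∫ x, f x ∂ξ = weightIntegral f w := by
  obtain ⟨_, hsub, hpos, hsum⟩ := hξ
  have hval : ∀ x ∈ s, (Finsupp.indicator s fun x _ => (ξ {x}).toReal) x = (ξ {x}).toReal :=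
    fun x hx => Finsupp.indicator_of_mem hx _
  have hsupp : (Finsupp.indicator s fun x _ => (ξ {x}).toReal).support = s := by
    refine (Finsupp.support_indicator_subset _ _).antisymm fun x hx => ?_
    rw [Finsupp.mem_support_iff, hval x hx]
    exact (ENNReal.toReal_pos (hpos x hx).ne' (measure_ne_top _ _)).ne'
  refine ⟨Finsupp.indicator s fun x _ => (ξ {x}).toReal, ⟨fun x => ?_, ?_⟩, hsupp, fun f => ?_⟩
  · rw [Finsupp.indicator_apply]; split_ifs <;> simp
  · rwa [hsupp]
  · conv_lhs => rw [hsum]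
    rw [integral_finsetSum_measure fun x _ =>
      (integrable_dirac (by simp)).smul_measure (measure_ne_top _ _),
      weightIntegral_eq_sum_of_subset f hsupp.subset]
    refine Finset.sum_congr rfl fun x hx => ?_
    rw [integral_smul_measure, integral_dirac, hval x hx, smul_eq_mul]

theorem IsWeightOn.exists_design {A B : ℝ} {w : ℝ →₀ ℝ} (hw : IsWeightOn A B w)
    (hmass : weightIntegral (fun _ => 1) w = 1) :
    ∃ ξ, IsDesignOn A B ξ w.support ∧ ∀ f : ℝ → ℝ, ∫ x, f x ∂ξ = weightIntegral f w := by
  set ξ : Measure ℝ := ∑ x ∈ w.support, ENNReal.ofReal (w x) • Measure.dirac x with hξ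
  have hval : ∀ x ∈ w.support, ξ {x} = ENNReal.ofReal (w x) := fun x hx => by
    rw [hξ, Measure.finsetSum_apply, Finset.sum_eq_single x]
    · simp
    · intro y _ hyx
      simp [hyx]
    · exact fun h => absurd hx h
  refine ⟨ξ, ⟨⟨?_⟩, hw.2, fun x hx => ?_, ?_⟩, fun f => ?_⟩
  · rw [weightIntegral_eq_sum_of_subset _ subset_rfl] at hmass
    simp only [mul_one] at hmass
    rw [hξ, Measure.finsetSum_apply]
    simp [← ENNReal.ofReal_sum_of_nonneg fun x _ => hw.1 x, hmass]
  · rw [hval x hx, ENNReal.ofReal_pos]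
    exact (hw.1 x).lt_of_ne' (Finsupp.mem_support_iff.1 hx)
  · conv_lhs => rw [hξ]
    exact Finset.sum_congr rfl fun x hx => by rw [hval x hx]
  · rw [hξ, integral_finsetSum_measure fun x _ =>
      (integrable_dirac (by simp)).smul_measure ENNReal.ofReal_ne_top,
      weightIntegral_eq_sum_of_subset f subset_rfl]
    refine Finset.sum_congr rfl fun x hx => ?_
    rw [integral_smul_measure, integral_dirac, ENNReal.toReal_ofReal (hw.1 x), smul_eq_mul]

theorem matrixIntegral_eq_sum {p : ℕ} (C : ℝ → Matrix (Fin p) (Fin p) ℝ) {ξ : Measure ℝ}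
    {w : ℝ →₀ ℝ} (h : ∀ f : ℝ → ℝ, ∫ x, f x ∂ξ = weightIntegral f w) :
    matrixIntegral C ξ = ∑ x ∈ w.support, w x • C x := by
  ext a b
  simp only [matrixIntegral, Matrix.of_apply, h, weightIntegral_eq_sum_of_subset _ subset_rfl,
    Matrix.sum_apply, Matrix.smul_apply, smul_eq_mul]

theorem matrixIntegral_isSymm {p : ℕ} {A B : ℝ} {C : ℝ → Matrix (Fin p) (Fin p) ℝ}
    (hC : ∀ x ∈ Set.Icc A B, (C x).IsSymm) {ξ : Measure ℝ} {w : ℝ →₀ ℝ} (hw : IsWeightOn A B w)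
    (h : ∀ f : ℝ → ℝ, ∫ x, f x ∂ξ = weightIntegral f w) : (matrixIntegral C ξ).IsSymm := by
  rw [matrixIntegral_eq_sum C h, Matrix.IsSymm, Matrix.transpose_sum]
  exact Finset.sum_congr rfl fun x hx => by rw [Matrix.transpose_smul, hC x (hw.2 hx)]

theorem dotProduct_matrixIntegral_mulVec {p : ℕ} (C : ℝ → Matrix (Fin p) (Fin p) ℝ)
    {ξ : Measure ℝ} {w : ℝ →₀ ℝ} (h : ∀ f : ℝ → ℝ, ∫ x, f x ∂ξ = weightIntegral f w)
    (Q : Fin p → ℝ) :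
    Q ⬝ᵥ (matrixIntegral C ξ *ᵥ Q) = weightIntegral (fun x => Q ⬝ᵥ (C x *ᵥ Q)) w := by
  rw [matrixIntegral_eq_sum C h, Matrix.sum_mulVec, dotProduct_sum,
    weightIntegral_eq_sum_of_subset _ subset_rfl]
  simp only [Matrix.smul_mulVec, dotProduct_smul, smul_eq_mul]

/-- A support of index at least `m` has `m` interior points or contains both endpoints. -/
theorem le_card_sdiff_or_mem_of_le_designIndex {A B : ℝ} {s : Finset ℝ} (hs : ↑s ⊆ Set.Icc A B)
    {m : ℕ} (h : (m : ℝ) ≤ designIndex A B s) : m ≤ (s \ {A, B}).card ∨ A ∈ s ∧ B ∈ s := by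
  classical
  by_contra! hcon
  obtain ⟨hlt, hAB⟩ := hcon
  have h1 : (s.filter fun x => x ∈ Set.Ioo A B).card ≤ (s \ {A, B}).card := by
    refine Finset.card_le_card fun x hx => ?_
    obtain ⟨hxs, hxA, hxB⟩ := Finset.mem_filter.1 hx
    simp [hxs, hxA.ne', hxB.ne]
  have h2 : (s.filter fun x => x = A ∨ x = B).card ≤ 1 := by
    refine Finset.card_le_one.2 fun x hx y hy => ?_
    obtain ⟨hxs, hx⟩ := Finset.mem_filter.1 hx
    obtain ⟨hys, hy⟩ := Finset.mem_filter.1 hy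
    rcases hx with rfl | rfl <;> rcases hy with rfl | rfl
    exacts [rfl, absurd hys (hAB hxs), absurd hxs (hAB hys), rfl]
  have h3 : ((s.filter fun x => x ∈ Set.Ioo A B).card : ℝ) + 1 ≤ m := by
    exact_mod_cast h1.trans_lt hlt
  have h4 : ((s.filter fun x => x = A ∨ x = B).card : ℝ) ≤ 1 := by exact_mod_cast h2
  have h5 : designIndex A B s = ((s.filter fun x => x ∈ Set.Ioo A B).card : ℝ) +
      ((s.filter fun x => x = A ∨ x = B).card : ℝ) / 2 := by
    unfold designIndex
    congr!
  linarith

/-- Yang–Stufken part (1), case (b): in the setting of the complete class theorem with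
`k` even and `I(ξ) ≥ k/2`, the dominating design `ξ⁺` can be chosen with at most
`(k+2)/2` support points, among which are both `A` and `B`. -/
theorem complete_class_upper_even
    {k p₁ : ℕ} (hk : 0 < k) (hp : 1 ≤ p₁) (A B : ℝ) (hAB : A < B)
    (Ψ : Fin k → ℝ → ℝ) (C : ℝ → Matrix (Fin p₁) (Fin p₁) ℝ)
    (hΨ0 : ∀ x : ℝ, Ψ ⟨0, hk⟩ x = 1)
    (hcontΨ : ∀ i, ContinuousOn (Ψ i) (Set.Icc A B))
    (hcontC : ∀ a b, ContinuousOn (fun x => C x a b) (Set.Icc A B))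
    (hsymm : ∀ x ∈ Set.Icc A B, (C x).IsSymm)
    (hCheb : IsChebyshevSystem A B Ψ)
    (hChebQ : ∀ Q : Fin p₁ → ℝ, Q ≠ 0 →
      IsChebyshevSystem A B (Fin.snoc Ψ fun x => Q ⬝ᵥ ((C x) *ᵥ Q)))
    (ξ : Measure ℝ) (s : Finset ℝ) (hξ : IsDesignOn A B ξ s)
    (heven : Even k) (hidx : (k : ℝ) / 2 ≤ designIndex A B s) :
    ∃ (ξp : Measure ℝ) (sp : Finset ℝ), IsDesignOn A B ξp sp ∧
      sp.card ≤ (k + 2) / 2 ∧ A ∈ sp ∧ B ∈ sp ∧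
      (∀ i, ∫ x, Ψ i x ∂ξp = ∫ x, Ψ i x ∂ξ) ∧
      (matrixIntegral C ξp - matrixIntegral C ξ).PosSemidef := by
  obtain ⟨m, rfl⟩ := heven.two_dvd
  have hm : 0 < m := by omega
  obtain ⟨w, hw, rfl, hwint⟩ := hξ.exists_weight
  have hG : {g | ∃ Q : Fin p₁ → ℝ, Q ≠ 0 ∧ g = fun x => Q ⬝ᵥ (C x *ᵥ Q)}.Nonempty :=
    ⟨_, fun _ => 1, fun h => one_ne_zero (congrFun h ⟨0, hp⟩), rfl⟩
  obtain ⟨v, hv, hvcard, hvA, hvB, hvm, hvg⟩ :=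
    hw.exists_dominating_endpoints hAB hm hCheb hcontΨ hΨ0 hG
      (by
        rintro _ ⟨Q, -, rfl⟩
        simp only [dotProduct, Matrix.mulVec]
        exact continuousOn_finsetSum _ fun a _ => continuousOn_const.mul
          (continuousOn_finsetSum _ fun b _ => (hcontC a b).mul continuousOn_const))
      (by
        rintro _ ⟨Q, hQ, rfl⟩
        exact hChebQ Q hQ)
      ((le_card_sdiff_or_mem_of_le_designIndex hw.2 (m := m)
        (by push_cast at hidx; linarith)).imp_right fun h =>
          ⟨(hw.1 A).lt_of_ne' (Finsupp.mem_support_iff.1 h.1),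
            (hw.1 B).lt_of_ne' (Finsupp.mem_support_iff.1 h.2)⟩)
  have hone : Ψ ⟨0, hk⟩ = fun _ => 1 := funext hΨ0
  have hmass : weightIntegral (fun _ => 1) v = 1 := by
    have := hξ.1
    rw [← hone, hvm, ← hwint]
    simp [hΨ0]
  obtain ⟨ξp, hξp, hvint⟩ := hv.exists_design hmass
  refine ⟨ξp, v.support, hξp, by omega, Finsupp.mem_support_iff.2 hvA.ne',
    Finsupp.mem_support_iff.2 hvB.ne', fun i => by rw [hvint, hwint, hvm], ?_⟩
  refine Matrix.PosSemidef.of_dotProduct_mulVec_nonneg ?_ fun Q => ?_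
  · have hsym := (matrixIntegral_isSymm hsymm hv hvint).sub (matrixIntegral_isSymm hsymm hw hwint)
    rwa [Matrix.IsHermitian, Matrix.conjTranspose_eq_transpose_of_trivial]
  · rw [star_trivial, Matrix.sub_mulVec, dotProduct_sub, dotProduct_matrixIntegral_mulVec C hvint,
      dotProduct_matrixIntegral_mulVec C hwint, sub_nonneg]
    rcases eq_or_ne Q 0 with rfl | hQ
    · simp [Finsupp.linearCombination_apply]
    · exact hvg _ ⟨Q, hQ, rfl⟩
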